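/- For all nonzero vectors a, b in H, the function f : [0,1] → ℝ defined by f(q) = ω_q(a⊗b) is concave on [0,1]; that is, for all q₁, q₂ ∈ [0,1] and t ∈ [0,1], f(t·q₁ + (1−t)·q₂) ≥ t·f(q₁) + (1−t)·f(q₂). -/

import Mathlib

open scoped ComplexInnerProductSpace

/-- The rank-one operator `a ⊗ b` on a complex Hilbert space, acting by
`(a ⊗ b) x = ⟨x, a⟩ · b` (i.e. `x ↦ ⟪a, x⟫ • b` in Mathlib's convention, where the
inner product is conjugate-linear in the first slot). -/
noncomputable def rankOne {H : Type*} [NormedAddCommGroup H] [InnerProductSpace ℂ H]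
    (a b : H) : H →L[ℂ] H :=
  (innerSL ℂ a).smulRight b

/-- The `q`-numerical radius `ω_q(A) = sup { |⟨Ax, y⟩| : ‖x‖ = ‖y‖ = 1, ⟨x, y⟩ = q }`. -/
noncomputable def qRad {H : Type*} [NormedAddCommGroup H] [InnerProductSpace ℂ H]
    (q : ℝ) (A : H →L[ℂ] H) : ℝ :=
  sSup {r : ℝ | ∃ x y : H, ‖x‖ = 1 ∧ ‖y‖ = 1 ∧ ⟪x, y⟫ = (q : ℂ) ∧ r = ‖⟪A x, y⟫‖}

section UnitVectors

variable {H : Type*} [NormedAddCommGroup H] [InnerProductSpace ℂ H]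

theorem norm_inner_rankOne (a b x y : H) :
    ‖⟪rankOne a b x, y⟫‖ = ‖⟪a, x⟫‖ * ‖⟪b, y⟫‖ := by
  simp [rankOne, norm_inner_symm x a, mul_comm]

theorem norm_inner_le_one_of_unit {u v : H} (hu : ‖u‖ = 1) (hv : ‖v‖ = 1) : ‖⟪u, v⟫‖ ≤ 1 := by
  simpa [hu, hv] using norm_inner_le_norm (𝕜 := ℂ) u v

theorem norm_sub_inner_smul {u v : H} (hu : ‖u‖ = 1) (hv : ‖v‖ = 1) :
    ‖u - ⟪v, u⟫ • v‖ = √(1 - ‖⟪v, u⟫‖ ^ 2) := by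
  rw [← Real.sqrt_sq (norm_nonneg (u - ⟪v, u⟫ • v)), @norm_sub_sq ℂ, inner_smul_right,
    ← inner_conj_symm u v, Complex.mul_conj, norm_smul, hu, hv, Complex.normSq_eq_norm_sq]
  congr 1
  simp only [RCLike.re_to_complex, Complex.ofReal_re]
  ring

theorem norm_inner_mul_sub_le {u v w : H} (hu : ‖u‖ = 1) (hv : ‖v‖ = 1) (hw : ‖w‖ = 1) :
    ‖⟪u, v⟫‖ * ‖⟪v, w⟫‖ - √(1 - ‖⟪u, v⟫‖ ^ 2) * √(1 - ‖⟪v, w⟫‖ ^ 2) ≤ ‖⟪u, w⟫‖ := by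
  have hvv : ⟪v, v⟫ = 1 := by rw [inner_self_eq_norm_sq_to_K, hv]; simp
  have key : ⟪u, v⟫ * ⟪v, w⟫ = ⟪u, w⟫ - ⟪u - ⟪v, u⟫ • v, w - ⟪v, w⟫ • v⟫ := by
    simp only [inner_sub_left, inner_sub_right, inner_smul_left, inner_smul_right,
      inner_conj_symm, hvv]
    ring
  have hcs := norm_inner_le_norm (𝕜 := ℂ) (u - ⟪v, u⟫ • v) (w - ⟪v, w⟫ • v)
  rw [norm_sub_inner_smul hu hv, norm_sub_inner_smul hw hv, norm_inner_symm v u] at hcs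
  rw [← norm_mul, key]
  linarith [norm_sub_le ⟪u, w⟫ ⟪u - ⟪v, u⟫ • v, w - ⟪v, w⟫ • v⟫]

/-- The triangle inequality for the Fubini–Study distance. -/
theorem arccos_norm_inner_le_add {u v w : H} (hu : ‖u‖ = 1) (hv : ‖v‖ = 1) (hw : ‖w‖ = 1) :
    Real.arccos ‖⟪u, w⟫‖ ≤ Real.arccos ‖⟪u, v⟫‖ + Real.arccos ‖⟪v, w⟫‖ := by
  have h₁ := Real.arccos_le_pi_div_two.2 (norm_nonneg ⟪u, v⟫)
  have h₂ := Real.arccos_le_pi_div_two.2 (norm_nonneg ⟪v, w⟫)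
  rw [← Real.arccos_cos (add_nonneg (Real.arccos_nonneg ‖⟪u, v⟫‖) (Real.arccos_nonneg ‖⟪v, w⟫‖))
    (by linarith)]
  apply Real.antitone_arccos
  rw [Real.cos_add, Real.sin_arccos, Real.sin_arccos,
    Real.cos_arccos (by linarith [norm_nonneg ⟪u, v⟫]) (norm_inner_le_one_of_unit hu hv),
    Real.cos_arccos (by linarith [norm_nonneg ⟪v, w⟫]) (norm_inner_le_one_of_unit hv hw)]
  exact norm_inner_mul_sub_le hu hv hw

theorem norm_inner_mul_norm_inner_le {a b x y : H} (ha : ‖a‖ = 1) (hb : ‖b‖ = 1)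
    (hx : ‖x‖ = 1) (hy : ‖y‖ = 1) :
    ‖⟪a, x⟫‖ * ‖⟪b, y⟫‖ ≤
      (1 + Real.cos (Real.arccos ‖⟪a, b⟫‖ - Real.arccos ‖⟪x, y⟫‖)) / 2 := by
  have h₁ := arccos_norm_inner_le_add ha hx hb
  have h₂ := arccos_norm_inner_le_add hx hy hb
  have h₃ := arccos_norm_inner_le_add hx ha hy
  have h₄ := arccos_norm_inner_le_add ha hb hy
  rw [norm_inner_symm y b] at h₂
  rw [norm_inner_symm x a] at h₃
  have hα := Real.arccos_le_pi_div_two.2 (norm_nonneg ⟪a, x⟫)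
  have hβ := Real.arccos_le_pi_div_two.2 (norm_nonneg ⟪b, y⟫)
  have cα := Real.cos_arccos (by linarith [norm_nonneg ⟪a, x⟫]) (norm_inner_le_one_of_unit ha hx)
  have cβ := Real.cos_arccos (by linarith [norm_nonneg ⟪b, y⟫]) (norm_inner_le_one_of_unit hb hy)
  set α := Real.arccos ‖⟪a, x⟫‖
  set β := Real.arccos ‖⟪b, y⟫‖
  have hcos : Real.cos (α + β) ≤ Real.cos (Real.arccos ‖⟪a, b⟫‖ - Real.arccos ‖⟪x, y⟫‖) := by
    rw [← Real.cos_abs (Real.arccos ‖⟪a, b⟫‖ - Real.arccos ‖⟪x, y⟫‖)]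
    apply Real.cos_le_cos_of_nonneg_of_le_pi (abs_nonneg _) (by linarith)
    rw [abs_le]
    constructor <;> linarith
  have hle := Real.cos_le_one (α - β)
  rw [Real.cos_add] at hcos
  rw [Real.cos_sub] at hle
  rw [← cα, ← cβ]
  linarith

theorem exists_unit_inner_eq_zero (hdim : 2 ≤ Module.rank ℂ H) (a : H) :
    ∃ e : H, ‖e‖ = 1 ∧ ⟪a, e⟫ = 0 := by
  have hne : (ℂ ∙ a)ᗮ ≠ ⊥ := by
    intro h
    rw [Submodule.orthogonal_eq_bot_iff] at h
    have hle : Module.rank ℂ (ℂ ∙ a) ≤ 1 := (rank_span_le {a}).trans (by simp)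
    rw [h, rank_top] at hle
    exact absurd (hdim.trans hle) (by norm_num)
  obtain ⟨w, hw, hw0⟩ := Submodule.exists_mem_ne_zero_of_ne_bot hne
  refine ⟨((‖w‖ : ℂ)⁻¹) • w, ?_, ?_⟩
  · simp [norm_smul, hw0]
  · rw [inner_smul_right, Submodule.mem_orthogonal_singleton_iff_inner_right.1 hw, mul_zero]

/-- A unit vector `b`, up to a phase, lies on a real unit circle through the unit vector `a`. -/
theorem exists_phase_smul_cos_add_sin (hdim : 2 ≤ Module.rank ℂ H) {a b : H}
    (ha : ‖a‖ = 1) (hb : ‖b‖ = 1) :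
    ∃ (ξ : ℂ) (e : H), ‖ξ‖ = 1 ∧ ‖e‖ = 1 ∧ ⟪a, e⟫ = 0 ∧
      b = ξ • ((Real.cos (Real.arccos ‖⟪a, b⟫‖) : ℂ) • a +
        (Real.sin (Real.arccos ‖⟪a, b⟫‖) : ℂ) • e) := by
  have haa : ⟪a, a⟫ = 1 := by rw [inner_self_eq_norm_sq_to_K, ha]; simp
  obtain ⟨ξ, hξ, hz⟩ : ∃ ξ : ℂ, ‖ξ‖ = 1 ∧ ⟪a, b⟫ = ξ * (‖⟪a, b⟫‖ : ℂ) :=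
    ⟨Complex.exp (Complex.arg ⟪a, b⟫ * Complex.I), Complex.norm_exp_ofReal_mul_I _, by
      rw [mul_comm, Complex.norm_mul_exp_arg_mul_I]⟩
  have hξ0 : ξ ≠ 0 := by rintro rfl; simp at hξ
  have hs := norm_sub_inner_smul hb ha
  rw [Real.cos_arccos (by linarith [norm_nonneg ⟪a, b⟫]) (norm_inner_le_one_of_unit ha hb),
    Real.sin_arccos, ← hs]
  set w := b - ⟪a, b⟫ • a with hw
  have hbw : b = (ξ * (‖⟪a, b⟫‖ : ℂ)) • a + w := by rw [← hz, hw]; abel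
  have haw : ⟪a, w⟫ = 0 := by rw [hw, inner_sub_right, inner_smul_right, haa]; ring
  by_cases hw0 : w = 0
  · obtain ⟨e, he, hae⟩ := exists_unit_inner_eq_zero hdim a
    refine ⟨ξ, e, hξ, he, hae, ?_⟩
    rw [hw0, norm_zero, Complex.ofReal_zero, zero_smul, add_zero, smul_smul, ← hz]
    exact sub_eq_zero.1 hw0
  · have hn : (‖w‖ : ℂ) ≠ 0 := by simpa using hw0
    refine ⟨ξ, (ξ⁻¹ * (‖w‖ : ℂ)⁻¹) • w, hξ, ?_, ?_, ?_⟩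
    · simp [norm_smul, hξ, hw0]
    · rw [inner_smul_right, haw, mul_zero]
    · rw [smul_add, smul_smul, smul_smul, smul_smul]
      convert hbw using 2
      rw [show ξ * (‖w‖ : ℂ) * (ξ⁻¹ * (‖w‖ : ℂ)⁻¹) = 1 by field_simp, one_smul]

theorem inner_cos_add_sin {a e : H} (ha : ‖a‖ = 1) (he : ‖e‖ = 1) (hae : ⟪a, e⟫ = 0) (u v : ℝ) :
    ⟪(Real.cos u : ℂ) • a + (Real.sin u : ℂ) • e, (Real.cos v : ℂ) • a + (Real.sin v : ℂ) • e⟫ =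
      (Real.cos (u - v) : ℂ) := by
  have haa : ⟪a, a⟫ = 1 := by rw [inner_self_eq_norm_sq_to_K, ha]; simp
  have hee : ⟪e, e⟫ = 1 := by rw [inner_self_eq_norm_sq_to_K, he]; simp
  have hea : ⟪e, a⟫ = 0 := by rw [← inner_conj_symm, hae, map_zero]
  simp only [inner_add_left, inner_add_right, inner_smul_left, inner_smul_right, haa, hee, hae,
    hea, Complex.conj_ofReal, Real.cos_sub]
  push_cast
  ring

theorem norm_cos_add_sin {a e : H} (ha : ‖a‖ = 1) (he : ‖e‖ = 1) (hae : ⟪a, e⟫ = 0) (u : ℝ) :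
    ‖(Real.cos u : ℂ) • a + (Real.sin u : ℂ) • e‖ = 1 := by
  have h := inner_cos_add_sin ha he hae u u
  rw [inner_self_eq_norm_sq_to_K, sub_self, Real.cos_zero] at h
  have h' : ‖(Real.cos u : ℂ) • a + (Real.sin u : ℂ) • e‖ ^ 2 = 1 := Complex.ofReal_injective <| by
    rw [Complex.ofReal_pow]
    exact h
  exact (pow_eq_one_iff_of_nonneg (norm_nonneg _) two_ne_zero).1 h'

theorem exists_norm_inner_mul_norm_inner_eq (hdim : 2 ≤ Module.rank ℂ H) {a b : H}
    (ha : ‖a‖ = 1) (hb : ‖b‖ = 1) {q : ℝ} (hq : q ∈ Set.Icc (0 : ℝ) 1) :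
    ∃ x y : H, ‖x‖ = 1 ∧ ‖y‖ = 1 ∧ ⟪x, y⟫ = (q : ℂ) ∧
      ‖⟪a, x⟫‖ * ‖⟪b, y⟫‖ = (1 + Real.cos (Real.arccos ‖⟪a, b⟫‖ - Real.arccos q)) / 2 := by
  obtain ⟨ξ, e, hξ, he, hae, hbe⟩ := exists_phase_smul_cos_add_sin hdim ha hb
  set θ := Real.arccos ‖⟪a, b⟫‖
  set φ := Real.arccos q
  have hax : a = (Real.cos 0 : ℂ) • a + (Real.sin 0 : ℂ) • e := by simp
  have h₁ : ‖⟪a, (Real.cos ((θ - φ) / 2) : ℂ) • a + (Real.sin ((θ - φ) / 2) : ℂ) • e⟫‖ =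
      |Real.cos ((θ - φ) / 2)| := by
    nth_rewrite 1 [hax]
    rw [inner_cos_add_sin ha he hae, Complex.norm_real, Real.norm_eq_abs, zero_sub, Real.cos_neg]
  have h₂ : ‖⟪b, (Real.cos ((θ + φ) / 2) : ℂ) • a + (Real.sin ((θ + φ) / 2) : ℂ) • e⟫‖ =
      |Real.cos ((θ - φ) / 2)| := by
    rw [hbe, inner_smul_left, inner_cos_add_sin ha he hae, norm_mul, RCLike.norm_conj, hξ, one_mul,
      Complex.norm_real, Real.norm_eq_abs]
    congr 2
    ring
  refine ⟨_, _, norm_cos_add_sin ha he hae ((θ - φ) / 2), norm_cos_add_sin ha he hae ((θ + φ) / 2),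
    ?_, ?_⟩
  · rw [inner_cos_add_sin ha he hae, show (θ - φ) / 2 - (θ + φ) / 2 = -φ by ring, Real.cos_neg,
      Real.cos_arccos (by linarith [hq.1]) hq.2]
  · rw [h₁, h₂, abs_mul_abs_self, ← sq, Real.cos_sq, mul_div_cancel₀ _ (two_ne_zero' ℝ)]
    ring

theorem qRad_rankOne (hdim : 2 ≤ Module.rank ℂ H) {a b : H}
    (ha : ‖a‖ = 1) (hb : ‖b‖ = 1) {r s : ℝ} (hr : 0 ≤ r) (hs : 0 ≤ s)
    {q : ℝ} (hq : q ∈ Set.Icc (0 : ℝ) 1) :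
    qRad q (rankOne ((r : ℂ) • a) ((s : ℂ) • b)) =
      r * s * ((1 + (‖⟪a, b⟫‖ * q + √(1 - ‖⟪a, b⟫‖ ^ 2) * √(1 - q ^ 2))) / 2) := by
  have hcos : Real.cos (Real.arccos ‖⟪a, b⟫‖ - Real.arccos q) =
      ‖⟪a, b⟫‖ * q + √(1 - ‖⟪a, b⟫‖ ^ 2) * √(1 - q ^ 2) := by
    rw [Real.cos_sub, Real.cos_arccos (by linarith [norm_nonneg ⟪a, b⟫])
      (norm_inner_le_one_of_unit ha hb), Real.cos_arccos (by linarith [hq.1]) hq.2,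
      Real.sin_arccos, Real.sin_arccos]
  have hval (x y : H) : ‖⟪rankOne ((r : ℂ) • a) ((s : ℂ) • b) x, y⟫‖ =
      r * s * (‖⟪a, x⟫‖ * ‖⟪b, y⟫‖) := by
    rw [norm_inner_rankOne, inner_smul_left, inner_smul_left, norm_mul, norm_mul,
      RCLike.norm_conj, RCLike.norm_conj, Complex.norm_of_nonneg hr, Complex.norm_of_nonneg hs]
    ring
  rw [← hcos]
  refine IsGreatest.csSup_eq ⟨?_, ?_⟩
  · obtain ⟨x, y, hx, hy, hxy, h⟩ := exists_norm_inner_mul_norm_inner_eq hdim ha hb hq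
    exact ⟨x, y, hx, hy, hxy, by rw [hval, h]⟩
  · rintro _ ⟨x, y, hx, hy, hxy, rfl⟩
    have h := norm_inner_mul_norm_inner_le ha hb hx hy
    rw [hxy, Complex.norm_of_nonneg hq.1] at h
    rw [hval]
    exact mul_le_mul_of_nonneg_left h (mul_nonneg hr hs)

end UnitVectors

theorem concaveOn_sqrt_one_sub_sq :
    ConcaveOn ℝ (Set.Icc (0 : ℝ) 1) fun q : ℝ => √(1 - q ^ 2) := by
  refine ⟨convex_Icc 0 1, fun p hp q hq t s ht hs hts => ?_⟩
  have hp' : 0 ≤ 1 - p ^ 2 := by nlinarith [hp.1, hp.2]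
  have hq' : 0 ≤ 1 - q ^ 2 := by nlinarith [hq.1, hq.2]
  have h := Real.strictConcaveOn_sqrt.concaveOn.2 hp' hq' ht hs hts
  refine h.trans (Real.sqrt_le_sqrt ?_)
  simp only [smul_eq_mul]
  obtain rfl : s = 1 - t := by linarith
  nlinarith [mul_nonneg (mul_nonneg ht hs) (sq_nonneg (p - q))]

/-- The function `q ↦ ω_q(a ⊗ b)` is concave on `[0, 1]`. -/
theorem stmt7 {H : Type*} [NormedAddCommGroup H] [InnerProductSpace ℂ H] [CompleteSpace H]
    (hdim : 2 ≤ Module.rank ℂ H) (a b : H) (ha : a ≠ 0) (hb : b ≠ 0)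
    (q₁ q₂ : ℝ) (hq₁ : q₁ ∈ Set.Icc (0 : ℝ) 1) (hq₂ : q₂ ∈ Set.Icc (0 : ℝ) 1)
    (t : ℝ) (ht : t ∈ Set.Icc (0 : ℝ) 1) :
    qRad (t * q₁ + (1 - t) * q₂) (rankOne a b) ≥
      t * qRad q₁ (rankOne a b) + (1 - t) * qRad q₂ (rankOne a b) := by
  have hunit {v : H} (hv : v ≠ 0) : ‖((‖v‖ : ℂ)⁻¹) • v‖ = 1 := by simp [norm_smul, hv]
  have hsmul {v : H} (hv : v ≠ 0) : v = (‖v‖ : ℂ) • ((‖v‖ : ℂ)⁻¹) • v := by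
    rw [smul_smul, mul_inv_cancel₀ (by simpa using hv), one_smul]
  have hq : t * q₁ + (1 - t) * q₂ ∈ Set.Icc (0 : ℝ) 1 :=
    convex_Icc (0 : ℝ) 1 hq₁ hq₂ ht.1 (sub_nonneg.2 ht.2) (by ring)
  have hconc := concaveOn_sqrt_one_sub_sq.2 hq₁ hq₂ ht.1 (sub_nonneg.2 ht.2) (by ring)
  simp only [smul_eq_mul] at hconc
  have hform {q : ℝ} (h : q ∈ Set.Icc (0 : ℝ) 1) := qRad_rankOne hdim (hunit ha) (hunit hb)
    (norm_nonneg a) (norm_nonneg b) h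
  simp only [← hsmul ha, ← hsmul hb] at hform
  rw [hform hq, hform hq₁, hform hq₂]
  set c := ‖⟪((‖a‖ : ℂ)⁻¹) • a, ((‖b‖ : ℂ)⁻¹) • b⟫‖
  have h := mul_le_mul_of_nonneg_left hconc
    (mul_nonneg (mul_nonneg (norm_nonneg a) (norm_nonneg b)) (Real.sqrt_nonneg (1 - c ^ 2)))
  linarith
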